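/- Let n ≥ 3 and k ≥ 1 be integers, let τ be an integer with 0 ≤ τ ≤ n², and set σ = n² − τ. Assume kn ≤ σ ≤ (k+1)n, that (k+1) divides σ − kn, and that k divides (k+1)n − σ. Then for A ∈ 𝒰(n,τ), per A = μ(n,τ) if and only if A is combinatorially equivalent to the matrix K_{n,σ}, the block-diagonal direct sum of (σ−kn)/(k+1) copies of J_{k+1} followed by ((k+1)n−σ)/k copies of J_k. -/

import Mathlib

open scoped BigOperators

namespace BGM

/-- The permanent of a square matrix with natural number entries. -/
def perm {n : ℕ} (M : Matrix (Fin n) (Fin n) ℕ) : ℕ :=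
  ∑ φ : Equiv.Perm (Fin n), ∏ i, M i (φ i)

/-- `M` is a (0,1)-matrix. -/
def IsZeroOne {n : ℕ} (M : Matrix (Fin n) (Fin n) ℕ) : Prop :=
  ∀ i j, M i j = 0 ∨ M i j = 1

/-- The number of entries of `M` equal to `0`. -/
def zeroCount {n : ℕ} (M : Matrix (Fin n) (Fin n) ℕ) : ℕ :=
  (Finset.univ.filter fun p : Fin n × Fin n => M p.1 p.2 = 0).card

/-- `𝒰(n, τ)`: the n×n (0,1)-matrices with exactly τ zero entries. -/
def Uclass (n τ : ℕ) : Set (Matrix (Fin n) (Fin n) ℕ) :=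
  {M | IsZeroOne M ∧ zeroCount M = τ}

/-- `μ(n, τ) = max {per A : A ∈ 𝒰(n, τ)}`. -/
noncomputable def mu (n τ : ℕ) : ℕ :=
  sSup (perm '' Uclass n τ)

/-- `𝒜(n, k)`: the n×n (0,1)-matrices with exactly k ones in each row and column. -/
def Aclass (n k : ℕ) : Set (Matrix (Fin n) (Fin n) ℕ) :=
  {M | IsZeroOne M ∧ (∀ i, ∑ j, M i j = k) ∧ (∀ j, ∑ i, M i j = k)}

/-- `P` is a permutation matrix. -/
def IsPermMatrix {n : ℕ} (P : Matrix (Fin n) (Fin n) ℕ) : Prop :=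
  ∃ e : Equiv.Perm (Fin n), ∀ i j, P i j = if j = e i then 1 else 0

/-- `A` and `B` are combinatorially equivalent: `B = PAQ` or `B = PAᵀQ` for
permutation matrices `P`, `Q`. -/
def CombEquiv {n : ℕ} (A B : Matrix (Fin n) (Fin n) ℕ) : Prop :=
  ∃ P Q, IsPermMatrix P ∧ IsPermMatrix Q ∧ (B = P * A * Q ∨ B = P * A.transpose * Q)

/-- Index of the block (of consecutive sizes `L`) containing position `i`. -/
def blockIdx : List ℕ → ℕ → ℕ
  | [], _ => 0
  | s :: L, i => if i < s then 0 else blockIdx L (i - s) + 1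

/-- The n×n block-diagonal direct sum of all-ones blocks of sizes `L`
(with `L.sum = n`). -/
def listBlocks (n : ℕ) (L : List ℕ) : Matrix (Fin n) (Fin n) ℕ :=
  Matrix.of fun i j => if blockIdx L (i : ℕ) = blockIdx L (j : ℕ) then 1 else 0

/-- The n×n block-diagonal matrix with a head block `B` (of size `m`) followed by
all-ones blocks of sizes `L` (with `m + L.sum = n`). -/
def headBlocks (n : ℕ) {m : ℕ} (B : Matrix (Fin m) (Fin m) ℕ) (L : List ℕ) :
    Matrix (Fin n) (Fin n) ℕ :=
  Matrix.of fun i j =>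
    if h : (i : ℕ) < m ∧ (j : ℕ) < m then B ⟨(i : ℕ), h.1⟩ ⟨(j : ℕ), h.2⟩
    else if m ≤ (i : ℕ) ∧ m ≤ (j : ℕ) ∧
        blockIdx L ((i : ℕ) - m) = blockIdx L ((j : ℕ) - m) then 1 else 0

/-- `M` with the `(i0, j0)` entry changed to `1`. -/
def setOne {n : ℕ} (M : Matrix (Fin n) (Fin n) ℕ) (i0 j0 : Fin n) :
    Matrix (Fin n) (Fin n) ℕ :=
  Matrix.of fun i j => if i = i0 ∧ j = j0 then 1 else M i j

/-- `J₃ - I₃`. -/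
def J3mI3 : Matrix (Fin 3) (Fin 3) ℕ := Matrix.of fun i j => if i = j then 0 else 1

/-- `J₄ - I₄`. -/
def J4mI4 : Matrix (Fin 4) (Fin 4) ℕ := Matrix.of fun i j => if i = j then 0 else 1

/-- `A₃`: the 3×3 all-ones matrix except the (1,1) entry is 0. -/
def A3 : Matrix (Fin 3) (Fin 3) ℕ := Matrix.of fun i j => if i = 0 ∧ j = 0 then 0 else 1

/-- `A₃ ⊕ I₂`. -/
def V5 : Matrix (Fin 5) (Fin 5) ℕ :=
  !![0,1,1,0,0; 1,1,1,0,0; 1,1,1,0,0; 0,0,0,1,0; 0,0,0,0,1]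

/-- `J₃ ⊕ I₂`. -/
def S5 : Matrix (Fin 5) (Fin 5) ℕ :=
  !![1,1,1,0,0; 1,1,1,0,0; 1,1,1,0,0; 0,0,0,1,0; 0,0,0,0,1]

/-- The head block of `W`. -/
def BW : Matrix (Fin 4) (Fin 4) ℕ :=
  !![0,0,1,1; 1,1,0,1; 1,1,1,0; 1,1,0,1]

/-- The head block of `X`. -/
def BX : Matrix (Fin 4) (Fin 4) ℕ :=
  !![0,0,1,1; 1,0,1,1; 1,1,0,1; 1,1,1,0]

/-- The head block of `Y`. -/
def BY : Matrix (Fin 4) (Fin 4) ℕ :=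
  !![0,0,1,1; 1,0,1,1; 1,1,0,0; 1,1,1,1]

/-- `A₃ ⊕ I₁`. -/
def T4 : Matrix (Fin 4) (Fin 4) ℕ :=
  !![0,1,1,0; 1,1,1,0; 1,1,1,0; 0,0,0,1]

/-- `A₄ ⊕ J₂`, where `A₄` is `J₄` with the (1,1) entry changed to 0. -/
def Q6 : Matrix (Fin 6) (Fin 6) ℕ :=
  !![0,1,1,1,0,0; 1,1,1,1,0,0; 1,1,1,1,0,0; 1,1,1,1,0,0; 0,0,0,0,1,1; 0,0,0,0,1,1]

/-- `J₃ ⊕ I₁`. -/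
def M4 : Matrix (Fin 4) (Fin 4) ℕ :=
  !![1,1,1,0; 1,1,1,0; 1,1,1,0; 0,0,0,1]

section Bregman
set_option linter.unusedSectionVars false
open Finset
variable {α : Type*} [Fintype α] [DecidableEq α] (N : α → Finset α)

/-- Permutations supported on `N`. -/
def bS : Finset (Equiv.Perm α) := univ.filter (fun σ => ∀ i, σ i ∈ N i)

/-- Permutations supported on `N` agreeing with `σ` on `T`. -/
def bF (T : Finset α) (σ : Equiv.Perm α) : Finset (Equiv.Perm α) :=
  (bS N).filter (fun τ => ∀ i ∈ T, τ i = σ i)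

/-- Number of available columns. -/
def bR (T : Finset α) (σ : Equiv.Perm α) (j : α) : ℕ :=
  ((N j).filter (fun k => σ.symm k ∉ T)).card

noncomputable def bh (r : ℕ) : ℝ := Real.log (r.factorial : ℝ) / r

noncomputable def bL (T : Finset α) (σ : Equiv.Perm α) : ℝ := Real.log ((bF N T σ).card : ℝ)

noncomputable def bH (T : Finset α) (σ : Equiv.Perm α) : ℝ := ∑ j ∈ Tᶜ, bh (bR N T σ j)

variable {N}

lemma mem_bF {T : Finset α} {σ τ : Equiv.Perm α} :
    τ ∈ bF N T σ ↔ (∀ i, τ i ∈ N i) ∧ ∀ i ∈ T, τ i = σ i := by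
  simp [bF, bS]

lemma self_mem_bF {T : Finset α} {σ : Equiv.Perm α} (h : σ ∈ bS N) : σ ∈ bF N T σ := by
  simp [bF, h]

lemma bF_congr {T : Finset α} {σ τ : Equiv.Perm α} (h : τ ∈ bF N T σ) :
    bF N T τ = bF N T σ := by
  ext ρ
  rw [mem_bF] at h
  simp only [mem_bF]
  constructor
  · rintro ⟨h1, h2⟩
    exact ⟨h1, fun i hi => (h2 i hi).trans (h.2 i hi)⟩
  · rintro ⟨h1, h2⟩
    exact ⟨h1, fun i hi => (h2 i hi).trans (h.2 i hi).symm⟩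

lemma bR_congr {T : Finset α} {σ τ : Equiv.Perm α} (h : τ ∈ bF N T σ) (j : α) :
    bR N T τ j = bR N T σ j := by
  rw [mem_bF] at h
  unfold bR
  congr 1
  apply filter_congr
  intro k _
  rw [not_iff_not]
  constructor
  · intro hk
    have := h.2 _ hk
    rw [Equiv.apply_symm_apply] at this
    rwa [this, Equiv.symm_apply_apply]
  · intro hk
    have := h.2 _ hk
    rw [Equiv.apply_symm_apply] at this
    rwa [← this, Equiv.symm_apply_apply]

lemma bH_congr {T : Finset α} {σ τ : Equiv.Perm α} (h : τ ∈ bF N T σ) :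
    bH N T τ = bH N T σ := by
  unfold bH
  exact sum_congr rfl fun j _ => by rw [bR_congr h]

lemma bR_insert (T : Finset α) (τ : Equiv.Perm α) (i j : α) (hi : i ∉ T) :
    bR N (insert i T) τ j = bR N T τ j - (if τ i ∈ N j then 1 else 0) := by
  unfold bR
  have : (N j).filter (fun k => τ.symm k ∉ insert i T)
      = ((N j).filter (fun k => τ.symm k ∉ T)).erase (τ i) := by
    ext k
    simp only [mem_filter, mem_insert, not_or, mem_erase, Equiv.symm_apply_eq]
    tauto
  rw [this]
  split_ifs with h
  · rw [card_erase_of_mem]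
    simp [h, hi]
  · rw [erase_eq_of_notMem]
    · simp
    · simp [h]

lemma bR_count (T : Finset α) (τ : Equiv.Perm α) (j : α) :
    bR N T τ j = (Tᶜ.filter (fun i => τ i ∈ N j)).card := by
  unfold bR
  symm
  apply card_bij (fun i _ => τ i)
  · intro i hi
    simp only [mem_filter, mem_compl] at hi
    simp [hi]
  · intro a _ b _ h
    exact τ.injective h
  · intro k hk
    simp only [mem_filter] at hk
    exact ⟨τ.symm k, by simp [hk], by simp⟩

lemma bh_pred (r : ℕ) (hr : 1 ≤ r) :
    ((r - 1 : ℕ) : ℝ) * bh (r - 1) + Real.log r = (r : ℝ) * bh r := by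
  obtain ⟨s, rfl⟩ : ∃ s, r = s + 1 := ⟨r - 1, by omega⟩
  unfold bh
  have h2 : ((s + 1 : ℕ) : ℝ) ≠ 0 := by positivity
  have h3 : ((s.factorial : ℕ) : ℝ) ≠ 0 := by positivity
  rw [mul_div_cancel₀ _ h2]
  rw [Nat.factorial_succ, Nat.cast_mul, Real.log_mul h2 h3]
  simp only [Nat.add_sub_cancel]
  rcases Nat.eq_zero_or_pos s with rfl | hs
  · simp
  · have : (s : ℝ) ≠ 0 := by positivity
    rw [mul_div_cancel₀ _ this]; ring

lemma bH_identity (T : Finset α) (τ : Equiv.Perm α) (hτ : τ ∈ bS N) :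
    ∑ i ∈ Tᶜ, bH N (insert i T) τ + ∑ i ∈ Tᶜ, Real.log (bR N T τ i)
      = (Tᶜ.card : ℝ) * bH N T τ := by
  have hτ' : ∀ i, τ i ∈ N i := by simpa [bS] using hτ
  have e1 : ∀ i ∈ Tᶜ, bH N (insert i T) τ
      = ∑ j ∈ Tᶜ, if j = i then 0 else bh (bR N T τ j - (if τ i ∈ N j then 1 else 0)) := by
    intro i hi
    unfold bH
    rw [compl_insert]
    rw [← sum_erase_add _ _ hi]
    simp only [if_true, add_zero]
    apply sum_congr rfl
    intro j hj
    rw [if_neg (ne_of_mem_erase hj), bR_insert _ _ _ _ (by simpa using hi)]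
  rw [sum_congr rfl e1, sum_comm, ← sum_add_distrib]
  unfold bH
  rw [mul_sum]
  apply sum_congr rfl
  intro j hj
  have hpos : 1 ≤ bR N T τ j := by
    rw [bR_count, Nat.one_le_iff_ne_zero, ← Nat.pos_iff_ne_zero, card_pos]
    exact ⟨j, by simp [hτ' j]; simpa using hj⟩
  have e2 : ∀ i ∈ Tᶜ, (if j = i then (0:ℝ) else bh (bR N T τ j - (if τ i ∈ N j then 1 else 0)))
      = bh (bR N T τ j) + (if τ i ∈ N j then (bh (bR N T τ j - 1) - bh (bR N T τ j)) else 0)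
        - (if j = i then bh (bR N T τ j - 1) else 0) := by
    intro i _
    by_cases h : j = i
    · subst h; simp [hτ' j]
    · simp only [if_neg h]
      split_ifs <;> simp
  rw [sum_congr rfl e2, sum_sub_distrib, sum_add_distrib, ← sum_filter, sum_const, sum_const,
    ← bR_count, sum_ite_eq, if_pos hj]
  have := bh_pred _ hpos
  rw [Nat.cast_sub hpos] at this
  simp only [nsmul_eq_mul]
  push_cast at this
  linarith

lemma bF_insert (T : Finset α) {σ τ : Equiv.Perm α} (h : τ ∈ bF N T σ) (i : α) :
    bF N (insert i T) τ = (bF N T σ).filter (fun ρ => ρ i = τ i) := by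
  rw [mem_bF] at h
  ext ρ
  simp only [mem_bF, mem_filter, mem_insert, forall_eq_or_imp]
  constructor
  · rintro ⟨a, b, c⟩
    exact ⟨⟨a, fun x hx => (c x hx).trans (h.2 x hx)⟩, b⟩
  · rintro ⟨⟨a, c⟩, b⟩
    exact ⟨a, b, fun x hx => (c x hx).trans (h.2 x hx).symm⟩

lemma jensen {β : Type*} [DecidableEq β] {γ : Type*} (F : Finset γ) (f : γ → β) :
    (F.card : ℝ) * Real.log F.card ≤ (F.card : ℝ) * Real.log ((F.image f).card : ℝ)
      + ∑ τ ∈ F, Real.log ((F.filter (fun ρ => f ρ = f τ)).card : ℝ) := by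
  rcases F.eq_empty_or_nonempty with rfl | hF
  · simp
  have hN : (0:ℝ) < F.card := by exact_mod_cast hF.card_pos
  have hs : (0:ℝ) < (F.image f).card := by exact_mod_cast (hF.image f).card_pos
  have hc : ∀ τ ∈ F, (0:ℝ) < (F.filter (fun ρ => f ρ = f τ)).card := by
    intro τ hτ
    have : 0 < (F.filter (fun ρ => f ρ = f τ)).card := card_pos.2 ⟨τ, by simp [hτ]⟩
    exact_mod_cast this
  have key : ∑ τ ∈ F, (1 / ((F.filter (fun ρ => f ρ = f τ)).card : ℝ)) = (F.image f).card := by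
    rw [← sum_fiberwise_of_maps_to (g := f) (t := F.image f) (fun x hx => mem_image_of_mem f hx)]
    rw [card_eq_sum_ones, Nat.cast_sum]
    apply sum_congr rfl
    intro b hb
    obtain ⟨τ, hτ, rfl⟩ := mem_image.1 hb
    rw [sum_congr rfl (g := fun _ => (1 / ((F.filter (fun ρ => f ρ = f τ)).card : ℝ)))]
    · rw [sum_const, nsmul_eq_mul, mul_one_div_cancel (hc τ hτ).ne']; simp
    · intro x hx
      rw [(mem_filter.1 hx).2]
  have : ∑ τ ∈ F, (Real.log F.card - Real.log ((F.image f).card : ℝ)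
      - Real.log ((F.filter (fun ρ => f ρ = f τ)).card : ℝ))
      ≤ ∑ τ ∈ F, (F.card / (F.image f).card * (1 / ((F.filter (fun ρ => f ρ = f τ)).card : ℝ)) - 1) := by
    apply sum_le_sum
    intro τ hτ
    have h := Real.log_le_sub_one_of_pos
      (show (0:ℝ) < F.card / (F.image f).card * (1 / ((F.filter (fun ρ => f ρ = f τ)).card : ℝ)) by
        have := hc τ hτ
        positivity)
    have h' := hc τ hτ
    rw [Real.log_mul (by positivity) (by positivity), Real.log_div (by positivity) (by positivity),
      one_div, Real.log_inv] at h
    rw [one_div]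
    linarith
  rw [sum_sub_distrib, sum_sub_distrib, sum_sub_distrib, ← mul_sum, key, div_mul_cancel₀ _ hs.ne'] at this
  simp only [sum_const, nsmul_eq_mul, mul_one] at this
  rw [sub_self] at this
  linarith

lemma image_sub (T : Finset α) (σ : Equiv.Perm α) (i : α) (hi : i ∉ T) :
    (bF N T σ).image (fun τ => τ i) ⊆ (N i).filter (fun k => σ.symm k ∉ T) := by
  intro k hk
  obtain ⟨τ, hτ, rfl⟩ := mem_image.1 hk
  rw [mem_bF] at hτ
  rw [mem_filter]
  refine ⟨hτ.1 i, fun h => hi ?_⟩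
  have := hτ.2 _ h
  rw [Equiv.apply_symm_apply] at this
  rwa [τ.injective this] at h

lemma log_image_le (T : Finset α) {σ : Equiv.Perm α} (hσ : σ ∈ bS N) (i : α) (hi : i ∉ T) :
    Real.log (((bF N T σ).image (fun τ => τ i)).card : ℝ) ≤ Real.log (bR N T σ i) := by
  apply Real.log_le_log
  · exact_mod_cast (Finset.Nonempty.image ⟨σ, self_mem_bF hσ⟩ _).card_pos
  · exact_mod_cast card_le_card (image_sub T σ i hi)

lemma bF_sub_bS {T : Finset α} {σ τ : Equiv.Perm α} (h : τ ∈ bF N T σ) : τ ∈ bS N :=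
  (mem_filter.1 h).1

lemma step (T : Finset α) {σ : Equiv.Perm α} (hσ : σ ∈ bS N)
    (ih : ∀ i ∈ Tᶜ, ∀ τ ∈ bF N T σ, bL N (insert i T) τ ≤ bH N (insert i T) τ) (hT : Tᶜ.Nonempty) :
    bL N T σ ≤ bH N T σ ∧ (bL N T σ = bH N T σ → ∀ i ∈ Tᶜ,
      (∀ τ ∈ bF N T σ, bL N (insert i T) τ = bH N (insert i T) τ) ∧
      (∀ k ∈ N i, σ.symm k ∉ T → ∃ τ ∈ bF N T σ, τ i = k)) := by
  set F := bF N T σ with hF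
  have hm : (0:ℝ) < Tᶜ.card := by exact_mod_cast hT.card_pos
  have hN : (0:ℝ) < F.card := by exact_mod_cast card_pos.2 ⟨σ, self_mem_bF hσ⟩
  let P : α → ℝ := fun i => (F.card : ℝ) * Real.log ((F.image (fun τ => τ i)).card : ℝ)
      + ∑ τ ∈ F, bL N (insert i T) τ
  let Q : α → ℝ := fun i => (F.card : ℝ) * Real.log (bR N T σ i : ℝ)
      + ∑ τ ∈ F, bH N (insert i T) τ
  have hJ : ∀ i ∈ Tᶜ, (F.card : ℝ) * bL N T σ ≤ P i := by
    intro i _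
    refine (jensen F (fun τ => τ i)).trans_eq ?_
    simp only [P]
    congr 1
    apply sum_congr rfl
    intro τ hτ
    rw [bL, bF_insert T hτ]
  have hPQ : ∀ i ∈ Tᶜ, P i ≤ Q i := by
    intro i hi
    apply add_le_add
    · exact mul_le_mul_of_nonneg_left (log_image_le T hσ i (by simpa using hi)) hN.le
    · exact sum_le_sum fun τ hτ => ih i hi τ hτ
  have hQ : ∑ i ∈ Tᶜ, Q i = (Tᶜ.card : ℝ) * ((F.card : ℝ) * bH N T σ) := by
    simp only [Q]
    rw [sum_add_distrib, sum_comm, ← mul_sum]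
    have : ∀ τ ∈ F, ∑ i ∈ Tᶜ, bH N (insert i T) τ
        = (Tᶜ.card : ℝ) * bH N T σ - ∑ i ∈ Tᶜ, Real.log (bR N T σ i) := by
      intro τ hτ
      rw [← bH_congr hτ, ← bH_identity T τ (bF_sub_bS hτ)]
      have e3 : ∑ i ∈ Tᶜ, Real.log (bR N T τ i) = ∑ i ∈ Tᶜ, Real.log (bR N T σ i) :=
        sum_congr rfl fun i _ => by rw [bR_congr hτ i]
      rw [e3, add_sub_cancel_right]
    rw [sum_congr rfl this, sum_const, nsmul_eq_mul]
    ring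
  have hle : ∑ i ∈ Tᶜ, (F.card : ℝ) * bL N T σ ≤ ∑ i ∈ Tᶜ, Q i :=
    sum_le_sum fun i hi => (hJ i hi).trans (hPQ i hi)
  have hle' := hle
  rw [hQ, sum_const, nsmul_eq_mul] at hle'
  refine ⟨le_of_mul_le_mul_left (le_of_mul_le_mul_left hle' hm) hN, ?_⟩
  intro heq i hi
  have hsum : ∑ i ∈ Tᶜ, (F.card : ℝ) * bL N T σ = ∑ i ∈ Tᶜ, Q i := by
    rw [hQ, sum_const, nsmul_eq_mul, heq]
  have h1 := (sum_eq_sum_iff_of_le fun i hi => (hJ i hi).trans (hPQ i hi)).1 hsum i hi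
  have h2 : P i = Q i := le_antisymm (hPQ i hi) (h1 ▸ hJ i hi)
  have ha := mul_le_mul_of_nonneg_left (log_image_le T hσ i (by simpa using hi)) hN.le
  have hb := sum_le_sum fun τ hτ => ih i hi τ hτ
  have hb' : ∑ τ ∈ F, bL N (insert i T) τ = ∑ τ ∈ F, bH N (insert i T) τ := by
    simp only [P, Q] at h2
    linarith
  refine ⟨(sum_eq_sum_iff_of_le fun τ hτ => ih i hi τ hτ).1 hb', ?_⟩
  have hc : Real.log ((F.image (fun τ => τ i)).card : ℝ) = Real.log (bR N T σ i : ℝ) := by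
    simp only [P, Q] at h2
    have : (F.card : ℝ) * Real.log ((F.image (fun τ => τ i)).card : ℝ)
        = (F.card : ℝ) * Real.log (bR N T σ i : ℝ) := by linarith
    exact mul_left_cancel₀ hN.ne' this
  have hp : 0 < (F.image (fun τ => τ i)).card :=
    (Finset.Nonempty.image ⟨σ, self_mem_bF hσ⟩ _).card_pos
  have hsub := image_sub (N := N) T σ i (by simpa using hi)
  have hp' : 0 < bR N T σ i := lt_of_lt_of_le hp (card_le_card hsub)
  have hd : (F.image (fun τ => τ i)).card = bR N T σ i := by
    have := Real.log_injOn_pos (by simpa using hp) (by simpa using hp') hc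
    exact_mod_cast this
  have he := eq_of_subset_of_card_le hsub (by rw [← hF, hd]; rfl)
  intro k hk hk'
  have : k ∈ (bF N T σ).image (fun τ => τ i) := by
    rw [he]; simp [hk, hk']
  simpa using this

lemma bL_le_bH (m : ℕ) : ∀ (T : Finset α) (σ : Equiv.Perm α), σ ∈ bS N → Tᶜ.card = m →
    bL N T σ ≤ bH N T σ := by
  induction m with
  | zero =>
    intro T σ hσ hT
    have hT' : T = univ := by simpa using hT
    subst hT'
    have : bF N univ σ = {σ} := by
      ext τ
      simp only [mem_bF, mem_singleton]
      constructor
      · rintro ⟨_, h⟩; exact Equiv.ext fun i => h i (mem_univ i)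
      · rintro rfl; exact ⟨by simpa [bS] using hσ, fun _ _ => rfl⟩
    simp [bL, bH, this]
  | succ m ih =>
    intro T σ hσ hT
    refine (step T hσ ?_ (card_pos.1 (by omega))).1
    intro i hi τ hτ
    refine ih _ _ (bF_sub_bS hτ) ?_
    rw [compl_insert, card_erase_of_mem hi, hT]; rfl

lemma eq_step (T : Finset α) {σ : Equiv.Perm α} (hσ : σ ∈ bS N) (h : bL N T σ = bH N T σ)
    (i : α) (hi : i ∉ T) :
      (∀ τ ∈ bF N T σ, bL N (insert i T) τ = bH N (insert i T) τ) ∧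
      (∀ k ∈ N i, σ.symm k ∉ T → ∃ τ ∈ bF N T σ, τ i = k) :=
  (step T hσ (fun _ _ _ hτ => bL_le_bH _ _ _ (bF_sub_bS hτ) rfl)
    ⟨i, by simpa using hi⟩).2 h i (by simpa using hi)

lemma eq_all (h : ∀ σ ∈ bS N, bL N ∅ σ = bH N ∅ σ) (T : Finset α) :
    ∀ σ ∈ bS N, bL N T σ = bH N T σ := by
  induction T using Finset.induction_on with
  | empty => exact h
  | insert i T hi ih =>
    intro σ hσ
    exact (eq_step T hσ (ih σ hσ) i hi).1 σ (self_mem_bF hσ)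

lemma bF_empty (σ : Equiv.Perm α) : bF N ∅ σ = bS N := by simp [bF]

lemma bH_empty (σ : Equiv.Perm α) : bH N ∅ σ = ∑ j, bh (N j).card := by simp [bH, bR]

/-- the Bregman inequality. -/
theorem bregman (hS : (bS N).Nonempty) :
    Real.log ((bS N).card : ℝ) ≤ ∑ j, bh (N j).card := by
  obtain ⟨σ, hσ⟩ := hS
  have := bL_le_bH _ ∅ σ hσ rfl
  rwa [bH_empty, bL, bF_empty] at this

/-- The equality case of the Bregman inequality. -/
theorem bregman_eq (hS : (bS N).Nonempty)
    (h : Real.log ((bS N).card : ℝ) = ∑ j, bh (N j).card) (p q j : α)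
    (hp : j ∈ N p) (hq : j ∈ N q) : N p = N q := by
  have hall := eq_all (N := N) (fun σ _ => by rw [bH_empty, bL, bF_empty, h])
  have hE : ∀ σ ∈ bS N, ∀ p q, p ≠ q → σ q ∈ N p → σ p ∈ N q := by
    intro σ hσ p q hpq hm
    obtain ⟨τ, hτ, hτp⟩ := (eq_step ({p, q}ᶜ : Finset α) hσ (hall _ σ hσ) p (by simp)).2
      (σ q) hm (by simp)
    rw [mem_bF] at hτ
    have : τ q = σ p := by
      obtain ⟨x, hx⟩ := τ.surjective (σ p)
      by_cases hxq : x = q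
      · rw [← hxq, hx]
      · by_cases hxp : x = p
        · subst hxp
          rw [hx] at hτp
          exact absurd (σ.injective hτp) hpq
        · have := hτ.2 x (by simp [hxp, hxq])
          rw [hx] at this
          exact absurd (σ.injective this).symm hxp
    rw [← this]
    exact hτ.1 q
  have main : ∀ p q, j ∈ N p → j ∈ N q → N p ⊆ N q := by
    intro p q hp hq l hl
    by_cases hpq : p = q
    · rwa [← hpq]
    obtain ⟨σ0, hσ0⟩ := hS
    obtain ⟨σ, hσ, hσp⟩ := (eq_step (∅ : Finset α) hσ0 (hall _ σ0 hσ0) p (by simp)).2 l hl (by simp)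
    have hσ := bF_sub_bS hσ
    have hσ' : ∀ i, σ i ∈ N i := by simpa [bS] using hσ
    obtain ⟨m, hm⟩ := σ.surjective j
    by_cases hmq : m = q
    · subst hmq
      have := hE σ hσ p m hpq (by rwa [hm])
      rwa [hσp] at this
    by_cases hmp : m = p
    · subst hmp
      rw [← hσp, hm]; exact hq
    have h1 := hE σ hσ p m (Ne.symm hmp) (by rwa [hm])
    have h2 := hE σ hσ q m (Ne.symm hmq) (by rwa [hm])
    let σ2 : Equiv.Perm α := σ * Equiv.swap q m
    have a1 : σ2 q = j := by simp [σ2, hm]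
    have a2 : σ2 m = σ q := by simp [σ2]
    have a3 : ∀ x, x ≠ q → x ≠ m → σ2 x = σ x := by
      intro x h1 h2
      simp [σ2, Equiv.swap_apply_of_ne_of_ne h1 h2]
    have hσ2 : σ2 ∈ bS N := by
      simp only [bS, mem_filter, mem_univ, true_and]
      intro x
      by_cases hx : x = q
      · subst hx; rwa [a1]
      by_cases hx' : x = m
      · subst hx'; rwa [a2]
      rw [a3 x hx hx']; exact hσ' x
    have := hE σ2 hσ2 p q hpq (by rwa [a1])
    rwa [a3 p hpq (Ne.symm hmp), hσp] at this
  exact (main p q hp hq).antisymm (main q p hq hp)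

end Bregman

section concave

lemma G_pos (k : ℕ) : 0 ≤ ((k:ℝ)^2 + 3 * k) * Real.log (k+1) - k * (k+1) * Real.log (k+2)
    - 2 * Real.log (k.factorial : ℝ) ∧ (1 ≤ k → 0 < ((k:ℝ)^2 + 3 * k) * Real.log (k+1)
    - k * (k+1) * Real.log (k+2) - 2 * Real.log (k.factorial : ℝ)) := by
  induction k with
  | zero => simp
  | succ k ih =>
    have h0 := ih.1
    suffices h : 0 < (((k+1:ℕ):ℝ)^2 + 3 * (k+1:ℕ)) * Real.log ((k+1:ℕ)+1)
        - (k+1:ℕ) * ((k+1:ℕ)+1) * Real.log ((k+1:ℕ)+2)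
        - 2 * Real.log ((k+1).factorial : ℝ) from ⟨h.le, fun _ => h⟩
    rw [Nat.factorial_succ, Nat.cast_mul, Real.log_mul (by positivity) (by positivity)]
    push_cast
    have hlog : Real.log (k+1) + Real.log (k+3) < 2 * Real.log (k+2) := by
      rw [← Real.log_mul (by positivity) (by positivity)]
      have : 2 * Real.log ((k:ℝ)+2) = Real.log (((k:ℝ)+2)^2) := by
        rw [Real.log_pow]; norm_num
      rw [this]
      apply Real.log_lt_log (by positivity)
      nlinarith
    have e1 : (k:ℝ) + 1 + 1 = k + 2 := by ring
    have e2 : (k:ℝ) + 1 + 2 = k + 3 := by ring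
    rw [e1, e2]
    have hpos : (0:ℝ) < (k:ℝ)^2 + 3 * k + 2 := by positivity
    have := mul_lt_mul_of_pos_left hlog hpos
    nlinarith

lemma d_anti (k : ℕ) (hk : 1 ≤ k) : bh (k+2) - bh (k+1) < bh (k+1) - bh k := by
  have h := (G_pos k).2 hk
  have hk0 : (0:ℝ) < k := by exact_mod_cast hk
  have b1 : bh (k+1) = (Real.log (k+1) + Real.log (k.factorial)) / (k+1) := by
    unfold bh
    rw [Nat.factorial_succ, Nat.cast_mul, Real.log_mul (by positivity) (by positivity)]
    push_cast; rfl
  have b2 : bh (k+2) = (Real.log (k+2) + Real.log (k+1) + Real.log (k.factorial)) / (k+2) := by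
    unfold bh
    rw [Nat.factorial_succ, Nat.factorial_succ, Nat.cast_mul, Nat.cast_mul,
      Real.log_mul (by positivity) (by positivity), Real.log_mul (by positivity) (by positivity)]
    push_cast
    rw [show (k:ℝ) + 1 + 1 = k + 2 by ring]
    ring
  have b0 : bh k = Real.log (k.factorial) / k := rfl
  rw [b1, b2, b0, ← sub_pos]
  have : (Real.log (k+1) + Real.log (k.factorial)) / ((k:ℝ)+1) - Real.log (k.factorial) / k
      - ((Real.log (k+2) + Real.log (k+1) + Real.log (k.factorial)) / ((k:ℝ)+2)
        - (Real.log (k+1) + Real.log (k.factorial)) / ((k:ℝ)+1))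
      = (((k:ℝ)^2 + 3 * k) * Real.log (k+1) - k * (k+1) * Real.log (k+2)
    - 2 * Real.log (k.factorial : ℝ)) / (k * (k+1) * (k+2)) := by
    field_simp
    ring
  rw [this]
  positivity

lemma d_anti' (k r : ℕ) (hk : 1 ≤ k) (hr : k < r) : bh (r+1) - bh r < bh (k+1) - bh k := by
  induction r, hr using Nat.le_induction with
  | base => exact d_anti k hk
  | succ r hr ih => exact (d_anti r (by omega)).trans ih

lemma tangent (k r : ℕ) (hk : 1 ≤ k) (hr : 1 ≤ r) :
    bh r ≤ bh k + ((r:ℝ) - k) * (bh (k+1) - bh k) ∧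
    (bh r = bh k + ((r:ℝ) - k) * (bh (k+1) - bh k) → r = k ∨ r = k + 1) := by
  by_cases h1 : r = k
  · subst h1; simp
  by_cases h2 : r = k + 1
  · subst h2; simp
  suffices h : bh r < bh k + ((r:ℝ) - k) * (bh (k+1) - bh k) from
    ⟨h.le, fun h' => absurd h' h.ne⟩
  rcases lt_or_gt_of_ne h1 with h | h
  · obtain ⟨d, rfl⟩ : ∃ d, k = r + 1 + d := ⟨k - r - 1, by omega⟩
    clear h1 h2 h
    induction d generalizing r with
    | zero =>
      have := d_anti r hr
      push_cast
      simp only [add_zero] at *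
      have e : r + 1 + 1 = r + 2 := rfl
      rw [e]
      linarith
    | succ d ih =>
      have h3 := ih (r+1) (by omega) (by omega)
      rw [show r + 1 + 1 + d = r + 1 + (d+1) by ring] at h3
      have h4 := d_anti' r (r + 1 + (d+1)) hr (by omega)
      push_cast at *
      linarith
  · have h' : k + 2 ≤ r := by omega
    clear h1 h2 h
    induction r, h' using Nat.le_induction with
    | base =>
      have := d_anti k hk
      push_cast
      linarith
    | succ r hr' ih =>
      have h3 := ih (by omega)
      have h4 := d_anti' k r hk (by omega)
      push_cast at *
      linarith

end concave

section blocks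
open Finset

lemma equiv_of_fibers {α β γ : Type*} [Fintype α] [Fintype β] [DecidableEq γ] (f : α → γ)
    (g : β → γ)
    (h : ∀ c, (univ.filter (fun a => f a = c)).card = (univ.filter (fun b => g b = c)).card) :
    ∃ e : α ≃ β, ∀ a, g (e a) = f a := by
  have h' : ∀ c, Nonempty ({a // f a = c} ≃ {b // g b = c}) := by
    intro c
    rw [← Fintype.card_eq, Fintype.card_subtype, Fintype.card_subtype]
    exact h c
  let E := fun c => Classical.choice (h' c)
  refine ⟨(Equiv.sigmaFiberEquiv f).symm.trans
    ((Equiv.sigmaCongrRight E).trans (Equiv.sigmaFiberEquiv g)), fun a => ?_⟩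
  exact (E (f a) ⟨a, rfl⟩).2

variable {α : Type*} [Fintype α] [DecidableEq α]

lemma class_fiber (f : α → Finset α) (hf : ∀ i j, j ∈ f i ↔ f j = f i) (i : α) :
    univ.filter (fun j => f j = f i) = f i := by
  ext j; simp [hf]

lemma class_count (f : α → Finset α) (hf : ∀ i j, j ∈ f i ↔ f j = f i) (s : ℕ) :
    (univ.filter (fun i => (f i).card = s)).card
      = ((univ.image f).filter (fun x => x.card = s)).card * s := by
  rw [card_eq_sum_card_fiberwise (f := f) (t := (univ.image f).filter (fun x => x.card = s))]
  · rw [sum_const_nat]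
    intro x hx
    obtain ⟨hx1, hx2⟩ := mem_filter.1 hx
    obtain ⟨i, -, rfl⟩ := mem_image.1 hx1
    rw [filter_filter, ← hx2]
    conv_rhs => rw [← class_fiber f hf i]
    congr 1
    apply filter_congr
    intro j _
    constructor
    · exact fun h => h.2
    · exact fun h => ⟨by rw [h], h⟩
  · intro i hi
    simpa using hi

lemma class_equiv (f g : α → Finset α) (hf : ∀ i j, j ∈ f i ↔ f j = f i)
    (hg : ∀ i j, j ∈ g i ↔ g j = g i)
    (h : ∀ s, (univ.filter (fun i => (f i).card = s)).card
      = (univ.filter (fun i => (g i).card = s)).card) :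
    ∃ e : Equiv.Perm α, ∀ i j, j ∈ f i ↔ e j ∈ g (e i) := by
  have hne : ∀ (f : α → Finset α), (∀ i j, j ∈ f i ↔ f j = f i) →
      ((univ.image f).filter (fun x => x.card = 0)) = ∅ := by
    intro f hf
    rw [filter_eq_empty_iff]
    intro x hx h0
    obtain ⟨i, -, rfl⟩ := mem_image.1 hx
    have : i ∈ f i := (hf i i).2 rfl
    rw [card_eq_zero.1 h0] at this
    simp at this
  have hcard : ∀ s, ((univ.image f).filter (fun x => x.card = s)).card
      = ((univ.image g).filter (fun x => x.card = s)).card := by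
    intro s
    rcases Nat.eq_zero_or_pos s with rfl | hs
    · rw [hne f hf, hne g hg]
    · have := h s
      rw [class_count f hf, class_count g hg] at this
      exact Nat.eq_of_mul_eq_mul_right hs this
  have hsub : ∀ (X : Finset (Finset α)) (s : ℕ),
      (univ.filter (fun a : X => a.1.card = s)).card = (X.filter (fun x => x.card = s)).card := by
    intro X s
    apply card_bij (fun a _ => a.1)
    · intro a ha; simpa using ha
    · intro a _ b _ hab; exact Subtype.ext hab
    · intro b hb
      obtain ⟨h1, h2⟩ := mem_filter.1 hb
      exact ⟨⟨b, h1⟩, by simpa using h2, rfl⟩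
  obtain ⟨E, hE⟩ := equiv_of_fibers (fun x : (univ.image f : Finset (Finset α)) => x.1.card)
    (fun x : (univ.image g : Finset (Finset α)) => x.1.card)
    (fun s => by rw [hsub, hsub, hcard])
  have hfm : ∀ i, f i ∈ univ.image f := fun i => mem_image_of_mem f (mem_univ i)
  have hgm : ∀ i, g i ∈ univ.image g := fun i => mem_image_of_mem g (mem_univ i)
  obtain ⟨e, he⟩ := equiv_of_fibers (fun i => E ⟨f i, hfm i⟩)
    (fun i => (⟨g i, hgm i⟩ : (univ.image g : Finset (Finset α)))) (by
      intro y
      obtain ⟨x, rfl⟩ := E.surjective y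
      have h1 : univ.filter (fun i => E ⟨f i, hfm i⟩ = E x) = x.1 := by
        obtain ⟨i, -, hi⟩ := mem_image.1 x.2
        conv_rhs => rw [← hi, ← class_fiber f hf i]
        apply filter_congr
        intro j _
        rw [E.injective.eq_iff, Subtype.ext_iff, hi]
      have h2 : univ.filter (fun i => (⟨g i, hgm i⟩ : (univ.image g : Finset (Finset α))) = E x)
          = (E x).1 := by
        obtain ⟨i, -, hi⟩ := mem_image.1 (E x).2
        conv_rhs => rw [← hi, ← class_fiber g hg i]
        apply filter_congr
        intro j _
        rw [Subtype.ext_iff, hi]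
      rw [h1, h2]
      exact (hE x).symm)
  refine ⟨e, fun i j => ?_⟩
  rw [hf, hg]
  have hi := he i
  have hj := he j
  constructor
  · intro hij
    have : E ⟨f j, hfm j⟩ = E ⟨f i, hfm i⟩ := by
      congr 1; exact Subtype.ext hij
    rw [← hi, ← hj] at this
    exact Subtype.ext_iff.1 this
  · intro hij
    have : E ⟨f j, hfm j⟩ = E ⟨f i, hfm i⟩ := by
      rw [← hi, ← hj]; exact Subtype.ext hij
    exact Subtype.ext_iff.1 (E.injective this)

/-- Neighbourhoods in a direct sum of all-ones blocks. -/
def gN {ι : Type*} [DecidableEq ι] (f : α → ι) (i : α) : Finset α :=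
  univ.filter (fun j => f i = f j)

lemma block_log {ι : Type*} [DecidableEq ι] (f : α → ι) :
    Real.log ((bS (gN f)).card : ℝ) = ∑ i, bh (gN f i).card := by
  have h1 : (bS (gN f)).card = ∏ c ∈ univ.image f, ((univ.filter (fun a => f a = c)).card).factorial := by
    have := DomMulAct.stabilizer_card' f
    rw [Fintype.card_subtype] at this
    simp only [Fintype.card_subtype] at this
    rw [← this]
    congr 1
    unfold bS
    apply filter_congr
    intro σ _
    simp only [gN, mem_filter, mem_univ, true_and, funext_iff, Function.comp]
    exact ⟨fun h i => (h i).symm, fun h i => (h i).symm⟩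
  rw [h1, Nat.cast_prod, Real.log_prod (fun c _ => by positivity)]
  rw [← sum_fiberwise_of_maps_to (g := f) (t := univ.image f)
    (fun x hx => mem_image_of_mem f hx)]
  apply sum_congr rfl
  intro c hc
  obtain ⟨i, -, rfl⟩ := mem_image.1 hc
  have : ∀ j ∈ univ.filter (fun a => f a = f i), bh (gN f j).card
      = bh (univ.filter (fun a => f a = f i)).card := by
    intro j hj
    have hj : f j = f i := by simpa using hj
    congr 2
    unfold gN
    rw [hj]
    exact filter_congr fun _ _ => eq_comm
  rw [sum_congr rfl this, sum_const, nsmul_eq_mul]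
  have hp : 0 < (univ.filter (fun a => f a = f i)).card := card_pos.2 ⟨i, by simp⟩
  unfold bh
  have : ((univ.filter (fun a => f a = f i)).card : ℝ) ≠ 0 := by positivity
  rw [mul_div_cancel₀ _ this]

lemma two_values (n k : ℕ) (u v : Fin n → ℕ) (hu : ∀ i, u i = k ∨ u i = k + 1)
    (hv : ∀ i, v i = k ∨ v i = k + 1) (h : ∑ i, u i = ∑ i, v i) (s : ℕ) :
    (univ.filter (fun i => u i = s)).card = (univ.filter (fun i => v i = s)).card := by
  have key : ∀ u : Fin n → ℕ, (∀ i, u i = k ∨ u i = k + 1) →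
      ∑ i, u i = n * k + (univ.filter (fun i => u i = k + 1)).card ∧
      (univ.filter (fun i => u i = k)).card + (univ.filter (fun i => u i = k + 1)).card = n := by
    intro u hu
    constructor
    · rw [card_filter, show n * k = ∑ i : Fin n, k by simp, ← sum_add_distrib]
      apply sum_congr rfl
      intro i _
      rcases hu i with h | h <;> simp [h]
    · rw [card_filter, card_filter, ← sum_add_distrib]
      have : ∀ i ∈ (univ : Finset (Fin n)),
          ((if u i = k then 1 else 0) + if u i = k + 1 then 1 else 0) = 1 := by
        intro i _
        rcases hu i with h | h <;> simp [h]
      rw [sum_congr rfl this]; simp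
  obtain ⟨a1, a2⟩ := key u hu
  obtain ⟨b1, b2⟩ := key v hv
  by_cases h1 : s = k
  · subst h1; omega
  by_cases h2 : s = k + 1
  · subst h2; omega
  rw [filter_eq_empty_iff.2, filter_eq_empty_iff.2]
  · intro i _ hi
    rcases hv i with h | h <;> omega
  · intro i _ hi
    rcases hu i with h | h <;> omega

lemma range_filter_add (p : ℕ → Prop) [DecidablePred p] (s m : ℕ) :
    ((range (s + m)).filter p).card
      = ((range s).filter p).card + ((range m).filter (fun j => p (s + j))).card := by
  rw [card_filter, card_filter, card_filter, sum_range_add]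

lemma blockIdx_count (L : List ℕ) : ∀ c, ((range L.sum).filter (fun j => blockIdx L j = c)).card
    = L.getD c 0 := by
  induction L with
  | nil => intro c; simp
  | cons s L ih =>
    intro c
    rw [List.sum_cons, range_filter_add]
    have e1 : ∀ j ∈ range s, (blockIdx (s :: L) j = c ↔ 0 = c) := by
      intro j hj
      rw [blockIdx, if_pos (mem_range.1 hj)]
    have e2 : ∀ j, blockIdx (s :: L) (s + j) = blockIdx L j + 1 := by
      intro j
      rw [blockIdx, if_neg (by omega)]; simp
    rw [filter_congr e1]
    simp only [e2]
    cases c with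
    | zero => simp
    | succ c =>
      simp only [Nat.add_right_cancel_iff, ih c]
      simp

lemma blockIdx_mem (L : List ℕ) : ∀ i < L.sum, L.getD (blockIdx L i) 0 ∈ L := by
  induction L with
  | nil => intro i hi; simp at hi
  | cons s L ih =>
    intro i hi
    rw [blockIdx]
    split_ifs with h
    · simp
    · have := ih (i - s) (by rw [List.sum_cons] at hi; omega)
      simp only [List.getD_cons_succ]
      exact List.mem_cons_of_mem _ this

lemma blockIdx_sq (L : List ℕ) : ∑ i ∈ range L.sum, L.getD (blockIdx L i) 0
    = (L.map (fun x => x * x)).sum := by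
  induction L with
  | nil => simp
  | cons s L ih =>
    rw [List.sum_cons, sum_range_add]
    have e1 : ∀ j ∈ range s, (s :: L).getD (blockIdx (s :: L) j) 0 = s := by
      intro j hj
      rw [blockIdx, if_pos (mem_range.1 hj)]; simp
    have e2 : ∀ j, (s :: L).getD (blockIdx (s :: L) (s + j)) 0 = L.getD (blockIdx L j) 0 := by
      intro j
      rw [blockIdx, if_neg (by omega)]; simp
    rw [sum_congr rfl e1]
    simp only [e2]
    rw [ih]
    simp

end blocks

section final
open Finset

/-- Support of row `i`. -/
def rN {n : ℕ} (A : Matrix (Fin n) (Fin n) ℕ) (i : Fin n) : Finset (Fin n) :=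
  univ.filter (fun j => A i j = 1)

lemma perm_eq {n : ℕ} (A : Matrix (Fin n) (Fin n) ℕ) (hA : IsZeroOne A) :
    perm A = (bS (rN A)).card := by
  unfold perm bS
  rw [card_filter]
  apply sum_congr rfl
  intro φ _
  split_ifs with h
  · apply prod_eq_one
    intro i _
    simpa [rN] using h i
  · push Not at h
    obtain ⟨i, hi⟩ := h
    apply prod_eq_zero (mem_univ i)
    rcases hA i (φ i) with h | h
    · exact h
    · simp [rN, h] at hi

lemma rows_sum {n : ℕ} (A : Matrix (Fin n) (Fin n) ℕ) (hA : IsZeroOne A) :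
    zeroCount A + ∑ i, (rN A i).card = n ^ 2 := by
  have h1 : ∑ i, (rN A i).card = (univ.filter (fun p : Fin n × Fin n => ¬ A p.1 p.2 = 0)).card := by
    rw [card_filter, Fintype.sum_prod_type]
    apply sum_congr rfl
    intro i _
    rw [rN, card_filter]
    apply sum_congr rfl
    intro j _
    rcases hA i j with h | h <;> simp [h]
  rw [h1, zeroCount, card_filter_add_card_filter_not]
  simp [sq]

lemma permMatrix_mul {n : ℕ} {P : Matrix (Fin n) (Fin n) ℕ} (e : Equiv.Perm (Fin n))
    (h : ∀ i j, P i j = if j = e i then 1 else 0) (M : Matrix (Fin n) (Fin n) ℕ) :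
    P * M = M.submatrix e id := by
  ext i j
  simp [Matrix.mul_apply, h]

lemma mul_permMatrix {n : ℕ} {P : Matrix (Fin n) (Fin n) ℕ} (e : Equiv.Perm (Fin n))
    (h : ∀ i j, P i j = if j = e i then 1 else 0) (M : Matrix (Fin n) (Fin n) ℕ) :
    M * P = M.submatrix id e.symm := by
  ext i j
  have : ∀ k, (j = e k) ↔ (k = e.symm j) := by
    intro k
    rw [Equiv.eq_symm_apply, eq_comm]
  simp [Matrix.mul_apply, h, this]

lemma perm_permanent {n : ℕ} (A : Matrix (Fin n) (Fin n) ℕ) : perm A = A.permanent := by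
  rw [← Matrix.permanent_transpose]; rfl

lemma combEquiv_perm {n : ℕ} {A B : Matrix (Fin n) (Fin n) ℕ} (h : CombEquiv A B) :
    perm A = perm B := by
  obtain ⟨P, Q, ⟨e, he⟩, ⟨q, hq⟩, h | h⟩ := h
  · rw [h, permMatrix_mul e he, mul_permMatrix q hq, perm_permanent, perm_permanent,
      Matrix.permanent_permute_rows, Matrix.permanent_permute_cols]
  · rw [h, permMatrix_mul e he, mul_permMatrix q hq, perm_permanent, perm_permanent,
      Matrix.permanent_permute_rows, Matrix.permanent_permute_cols, Matrix.permanent_transpose]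

lemma main_bound (n k : ℕ) (hk : 1 ≤ k) (f : Fin n → ℕ) (A : Matrix (Fin n) (Fin n) ℕ)
    (hA : IsZeroOne A)
    (hf : ∀ i, (gN f i).card = k ∨ (gN f i).card = k + 1)
    (hsum : ∑ i, (rN A i).card = ∑ i, (gN f i).card) :
    perm A ≤ (bS (gN f)).card ∧ (perm A = (bS (gN f)).card →
      CombEquiv A (Matrix.of fun i j => if f i = f j then 1 else 0)) := by
  have hKpos : 0 < (bS (gN f)).card := card_pos.2 ⟨1, by simp [bS, gN]⟩
  rw [perm_eq A hA]
  rcases (bS (rN A)).eq_empty_or_nonempty with he | hne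
  · rw [he, card_empty]
    exact ⟨Nat.zero_le _, fun h => absurd h hKpos.ne⟩
  have hApos : 0 < (bS (rN A)).card := hne.card_pos
  obtain ⟨φ, hφ⟩ := id hne
  have hφ' : ∀ i, φ i ∈ rN A i := by simpa [bS] using hφ
  have hr : ∀ i, 1 ≤ (rN A i).card := fun i => card_pos.2 ⟨_, hφ' i⟩
  have hB := bregman hne
  have hT : ∑ i, bh (rN A i).card
      ≤ ∑ i, (bh k + (((rN A i).card : ℝ) - k) * (bh (k+1) - bh k)) :=
    sum_le_sum fun i _ => (tangent k _ hk (hr i)).1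
  have hlin : ∑ i, (bh k + (((rN A i).card : ℝ) - k) * (bh (k+1) - bh k))
      = ∑ i, (bh k + (((gN f i).card : ℝ) - k) * (bh (k+1) - bh k)) := by
    rw [sum_add_distrib, sum_add_distrib, ← sum_mul, ← sum_mul, sum_sub_distrib, sum_sub_distrib]
    have : ∑ i, ((rN A i).card : ℝ) = ∑ i, ((gN f i).card : ℝ) := by exact_mod_cast hsum
    rw [this]
  have hK : Real.log ((bS (gN f)).card : ℝ)
      = ∑ i, (bh k + (((gN f i).card : ℝ) - k) * (bh (k+1) - bh k)) := by
    rw [block_log]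
    apply sum_congr rfl
    intro i _
    rcases hf i with h | h <;> rw [h] <;> push_cast <;> ring
  constructor
  · have : Real.log ((bS (rN A)).card : ℝ) ≤ Real.log ((bS (gN f)).card : ℝ) := by linarith
    have := (Real.log_le_log_iff (by exact_mod_cast hApos) (by exact_mod_cast hKpos)).1 this
    exact_mod_cast this
  intro heq
  rw [← heq] at hK
  have hE1 : Real.log ((bS (rN A)).card : ℝ) = ∑ i, bh (rN A i).card := by linarith
  have hE2 : ∑ i, bh (rN A i).card
      = ∑ i, (bh k + (((rN A i).card : ℝ) - k) * (bh (k+1) - bh k)) := by linarith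
  have hE3 := (sum_eq_sum_iff_of_le fun i _ => (tangent k _ hk (hr i)).1).1 hE2
  have hrow : ∀ i, (rN A i).card = k ∨ (rN A i).card = k + 1 := fun i =>
    (tangent k _ hk (hr i)).2 (hE3 i (mem_univ i))
  have hblock := bregman_eq hne hE1
  let B : Fin n → Finset (Fin n) := fun i => univ.filter (fun j => φ j ∈ rN A i)
  have hBc : ∀ i, (B i).card = (rN A i).card := by
    intro i
    apply card_bij (fun j _ => φ j)
    · intro j hj; simpa [B] using hj
    · intro a _ b _ h; exact φ.injective h
    · intro j hj; exact ⟨φ.symm j, by simpa [B] using hj, by simp⟩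
  have hBf : ∀ i j, j ∈ B i ↔ B j = B i := by
    intro i j
    constructor
    · intro hj
      have hj : φ j ∈ rN A i := by simpa [B] using hj
      have := hblock j i (φ j) (hφ' j) hj
      simp only [B, this]
    · intro h
      rw [← h]
      simpa [B] using hφ' j
  have hGf : ∀ i j, j ∈ gN f i ↔ gN f j = gN f i := by
    intro i j
    constructor
    · intro hj
      have hj : f i = f j := by simpa [gN] using hj
      simp only [gN, hj]
    · intro h
      rw [← h]
      simp [gN]
  obtain ⟨e, he⟩ := class_equiv (gN f) B hGf hBf (by
    intro s
    simp only [hBc]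
    exact two_values n k _ _ hf hrow hsum.symm s)
  let q : Equiv.Perm (Fin n) := (e.trans φ).symm
  refine ⟨Matrix.of fun i j => if j = e i then 1 else 0,
    Matrix.of fun i j => if j = q i then 1 else 0,
    ⟨e, fun _ _ => rfl⟩, ⟨q, fun _ _ => rfl⟩, Or.inl ?_⟩
  rw [permMatrix_mul (P := Matrix.of fun i j => if j = e i then 1 else 0) e (fun _ _ => rfl),
    mul_permMatrix (P := Matrix.of fun i j => if j = q i then 1 else 0) q (fun _ _ => rfl)]
  ext i j
  have h1 : f i = f j ↔ A (e i) (φ (e j)) = 1 := by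
    have := he i j
    simpa [gN, B, rN] using this
  simp only [Matrix.of_apply, Matrix.submatrix_apply, id, q, Equiv.symm_symm, Equiv.trans_apply]
  split_ifs with h
  · exact (h1.1 h).symm
  · rcases hA (e i) (φ (e j)) with h' | h'
    · exact h'.symm
    · exact absurd (h1.2 h') h

end final

theorem stmt1 (n k τ σ : ℕ) (hn : 3 ≤ n) (hk : 1 ≤ k) (hτ : τ ≤ n ^ 2)
    (hσ : σ = n ^ 2 - τ)
    (h1 : k * n ≤ σ) (h2 : σ ≤ (k + 1) * n)
    (h3 : (k + 1) ∣ σ - k * n) (h4 : k ∣ (k + 1) * n - σ) :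
    ∀ A ∈ Uclass n τ, (perm A = mu n τ ↔
      CombEquiv A (listBlocks n
        (List.replicate ((σ - k * n) / (k + 1)) (k + 1) ++
          List.replicate (((k + 1) * n - σ) / k) k))) := by
  have hk0 : 0 < k := hk
  obtain ⟨a, ha⟩ := h3
  obtain ⟨b, hb⟩ := h4
  rw [ha, hb, Nat.mul_div_cancel_left _ (by omega), Nat.mul_div_cancel_left _ hk0]
  set L := List.replicate a (k + 1) ++ List.replicate b k with hL
  have ha' : (k + 1) * a + k * n = σ := by omega
  have hb' : k * b + σ = (k + 1) * n := by omega
  have hLsum : L.sum = n := by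
    simp only [hL, List.sum_append, List.sum_replicate, smul_eq_mul]
    nlinarith
  have hLsq : (L.map (fun x => x * x)).sum = σ := by
    simp only [hL, List.map_append, List.map_replicate, List.sum_append, List.sum_replicate,
      smul_eq_mul]
    nlinarith
  let f : Fin n → ℕ := fun i => blockIdx L i
  have hcard : ∀ i : Fin n, (gN f i).card = L.getD (blockIdx L i) 0 := by
    intro i
    rw [← blockIdx_count L, hLsum, gN, Finset.card_filter, Finset.card_filter]
    rw [← Fin.sum_univ_eq_sum_range (fun j => if blockIdx L j = blockIdx L i then 1 else 0) n]
    apply Finset.sum_congr rfl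
    intro j _
    simp only [f, eq_comm]
  have hf : ∀ i, (gN f i).card = k ∨ (gN f i).card = k + 1 := by
    intro i
    have hm := blockIdx_mem L i (by rw [hLsum]; exact i.2)
    rw [← hcard i, hL, List.mem_append] at hm
    rcases hm with hm | hm
    · exact Or.inr (List.eq_of_mem_replicate hm)
    · exact Or.inl (List.eq_of_mem_replicate hm)
  have hfsum : ∑ i, (gN f i).card = σ := by
    simp only [hcard]
    rw [Fin.sum_univ_eq_sum_range (fun i => L.getD (blockIdx L i) 0) n]
    have := blockIdx_sq L
    rwa [hLsum, hLsq] at this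
  have hK01 : IsZeroOne (listBlocks n L) := by
    intro i j
    simp only [listBlocks, Matrix.of_apply]
    split_ifs <;> simp
  have hKN : rN (listBlocks n L) = gN f := by
    funext i
    simp [rN, gN, listBlocks, f]
  have hKperm : perm (listBlocks n L) = (bS (gN f)).card := by
    rw [perm_eq _ hK01, hKN]
  have hKU : listBlocks n L ∈ Uclass n τ := by
    refine ⟨hK01, ?_⟩
    have := rows_sum _ hK01
    rw [hKN, hfsum] at this
    omega
  have hmain : ∀ A ∈ Uclass n τ, perm A ≤ perm (listBlocks n L) ∧
      (perm A = perm (listBlocks n L) → CombEquiv A (listBlocks n L)) := by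
    intro A hA
    rw [hKperm]
    refine main_bound n k hk f A hA.1 hf ?_
    have := rows_sum A hA.1
    rw [hA.2] at this
    rw [hfsum]
    omega
  have hmu : mu n τ = perm (listBlocks n L) := by
    apply IsGreatest.csSup_eq
    refine ⟨⟨_, hKU, rfl⟩, ?_⟩
    rintro _ ⟨A, hA, rfl⟩
    exact (hmain A hA).1
  intro A hA
  rw [hmu]
  exact ⟨(hmain A hA).2, combEquiv_perm⟩

end BGM
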